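/- Let S be the sphere of radius r > 0 centered at a point c in three-dimensional Euclidean space ℝ³, let x ∈ S, and for ε > 0 let C = {y ∈ S : ‖x − y‖ < ε} be the open spherical cap around x. If T : ℝ³ → ℝ² is a (real) linear transformation, then the image T(C) is a convex subset of ℝ², and there exists δ > 0 such that {δ·T(s) + (1−δ)·T(x) : s ∈ S} ⊆ T(C). -/

import Mathlib

section SphericalCap

variable {E F : Type*} [NormedAddCommGroup E] [InnerProductSpace ℝ E]

/-- The part of a closed ball cut off by the half-space that cuts the cap of radius `ε` around `x`
out of the bounding sphere. -/
def solidCap (c : E) (r : ℝ) (x : E) (ε : ℝ) : Set E :=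
  {y | ‖y - c‖ ≤ r ∧ 2 * r ^ 2 - 2 * inner ℝ (y - c) (x - c) < ε ^ 2}

theorem convex_solidCap (c : E) (r : ℝ) (x : E) (ε : ℝ) : Convex ℝ (solidCap c r x ε) := by
  have hball : Convex ℝ {y : E | ‖y - c‖ ≤ r} := by
    simpa [Metric.closedBall, dist_eq_norm] using convex_closedBall c r
  have hhalf : Convex ℝ {y : E | 2 * r ^ 2 - 2 * inner ℝ (y - c) (x - c) < ε ^ 2} := by
    intro y hy z hz a b ha hb hab
    rw [Set.mem_ofPred_eq] at hy hz ⊢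
    obtain rfl : b = 1 - a := by linarith
    have hsplit : a • y + (1 - a) • z - c = a • (y - c) + (1 - a) • (z - c) := by module
    rw [hsplit, inner_add_left, real_inner_smul_left, real_inner_smul_left]
    rcases ha.eq_or_lt with rfl | ha
    · linarith
    · linarith [mul_lt_mul_of_pos_left hy ha, mul_le_mul_of_nonneg_left hz.le hb]
  exact hball.inter hhalf

theorem norm_sub_sq_of_mem_sphere {c x y : E} {r : ℝ} (hx : ‖x - c‖ = r) (hy : ‖y - c‖ = r) :
    ‖x - y‖ ^ 2 = 2 * r ^ 2 - 2 * inner ℝ (y - c) (x - c) := by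
  rw [← sub_sub_sub_cancel_right x y c, norm_sub_sq_real, hx, hy, real_inner_comm]
  ring

theorem exists_nonneg_norm_add_smul_eq {v u : E} {r : ℝ} (hv : ‖v‖ ≤ r) (hu : u ≠ 0) :
    ∃ t : ℝ, 0 ≤ t ∧ ‖v + t • u‖ = r := by
  have hu' : 0 < ‖u‖ := norm_pos_iff.mpr hu
  have hr : 0 ≤ r := (norm_nonneg v).trans hv
  have ht : 0 ≤ 2 * r / ‖u‖ := by positivity
  have hcont : ContinuousOn (fun t : ℝ => ‖v + t • u‖) (Set.Icc 0 (2 * r / ‖u‖)) := by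
    fun_prop
  have hfar : r ≤ ‖v + (2 * r / ‖u‖) • u‖ := by
    have hnorm : ‖(2 * r / ‖u‖) • u‖ = 2 * r := by
      rw [norm_smul, Real.norm_of_nonneg ht, div_mul_cancel₀ _ hu'.ne']
    have := norm_sub_norm_le ((2 * r / ‖u‖) • u) (-v)
    rw [sub_neg_eq_add, norm_neg, hnorm, add_comm] at this
    linarith
  obtain ⟨t, ht, htr⟩ := intermediate_value_Icc ht hcont ⟨by simpa using hv, hfar⟩
  exact ⟨t, ht.1, htr⟩

/-- A noninjective linear map does not distinguish a spherical cap from the solid cap it bounds: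
one can move along a kernel direction into the half-space until the sphere is reached. -/
theorem image_sphericalCap_eq_image_solidCap [AddCommGroup F] [Module ℝ F]
    (T : E →ₗ[ℝ] F) (hT : LinearMap.ker T ≠ ⊥)
    {c x : E} {r ε : ℝ} (hx : ‖x - c‖ = r) (hε : 0 < ε) :
    T '' {y | ‖y - c‖ = r ∧ ‖x - y‖ < ε} = T '' solidCap c r x ε := by
  apply Set.Subset.antisymm
  · apply Set.image_mono
    rintro y ⟨hy, hxy⟩
    refine ⟨hy.le, ?_⟩
    rw [← norm_sub_sq_of_mem_sphere hx hy]
    gcongr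
  · rintro _ ⟨y, ⟨hy, hcut⟩, rfl⟩
    obtain ⟨u, hu, hu0, hdir⟩ : ∃ u, T u = 0 ∧ u ≠ 0 ∧ 0 ≤ inner ℝ u (x - c) := by
      obtain ⟨u, hu, hu0⟩ := (Submodule.ne_bot_iff _).mp hT
      rw [LinearMap.mem_ker] at hu
      rcases le_total 0 (inner ℝ u (x - c)) with h | h
      · exact ⟨u, hu, hu0, h⟩
      · exact ⟨-u, by simp [hu], neg_ne_zero.mpr hu0, by rw [inner_neg_left]; linarith⟩
    obtain ⟨t, ht, htr⟩ := exists_nonneg_norm_add_smul_eq hy hu0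
    have hsub : y + t • u - c = y - c + t • u := by abel
    have hsphere : ‖y + t • u - c‖ = r := by rw [hsub, htr]
    refine ⟨y + t • u, ⟨hsphere, ?_⟩, by simp [hu]⟩
    refine lt_of_pow_lt_pow_left₀ 2 hε.le ?_
    rw [norm_sub_sq_of_mem_sphere hx hsphere, hsub, inner_add_left, real_inner_smul_left]
    linarith [mul_nonneg ht hdir]

theorem exists_homothety_sphere_mem_solidCap {c x : E} {r ε : ℝ} (hr : 0 < r)
    (hx : ‖x - c‖ = r) (hε : 0 < ε) :
    ∃ δ : ℝ, 0 < δ ∧ ∀ s, ‖s - c‖ = r → δ • s + (1 - δ) • x ∈ solidCap c r x ε := by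
  obtain ⟨δ, hδ, hδ'⟩ : ∃ δ : ℝ, 0 < δ ∧ δ < min 1 (ε ^ 2 / (4 * r ^ 2)) :=
    exists_between (by positivity)
  obtain ⟨hδ1, hδε⟩ := lt_min_iff.mp hδ'
  rw [lt_div_iff₀ (by positivity)] at hδε
  refine ⟨δ, hδ, fun s hs => ?_⟩
  have hsplit : δ • s + (1 - δ) • x - c = δ • (s - c) + (1 - δ) • (x - c) := by module
  constructor
  · rw [hsplit]
    refine (norm_add_le _ _).trans_eq ?_
    rw [norm_smul, norm_smul, hs, hx, Real.norm_of_nonneg hδ.le,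
      Real.norm_of_nonneg (by linarith)]
    ring
  · have hinner : -(r * r) ≤ inner ℝ (s - c) (x - c) := by
      have := neg_le_of_abs_le (abs_real_inner_le_norm (s - c) (x - c))
      rwa [hs, hx] at this
    rw [hsplit, inner_add_left, real_inner_smul_left, real_inner_smul_left,
      real_inner_self_eq_norm_sq, hx]
    linarith [mul_le_mul_of_nonneg_left hinner hδ.le]

end SphericalCap

/-- Lemma on spherical caps: if `S` is a sphere of radius `r > 0` centered at `c` in `ℝ³`,
`x ∈ S`, `C` is the open spherical cap `{y ∈ S : ‖x - y‖ < ε}`, and `T : ℝ³ → ℝ²` is linear,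
then `T(C)` is convex and there is `δ > 0` with `δ • T(S) + (1 - δ) • T(x) ⊆ T(C)`. -/
theorem sphericalCap_image_convex_and_scaling
    (c : EuclideanSpace ℝ (Fin 3)) (r : ℝ) (hr : 0 < r)
    (T : EuclideanSpace ℝ (Fin 3) →ₗ[ℝ] EuclideanSpace ℝ (Fin 2))
    (x : EuclideanSpace ℝ (Fin 3)) (hx : ‖x - c‖ = r) (ε : ℝ) (hε : 0 < ε) :
    Convex ℝ (T '' {y : EuclideanSpace ℝ (Fin 3) | ‖y - c‖ = r ∧ ‖x - y‖ < ε}) ∧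
      ∃ δ : ℝ, 0 < δ ∧
        ((fun s : EuclideanSpace ℝ (Fin 3) => δ • T s + (1 - δ) • T x) ''
            {y : EuclideanSpace ℝ (Fin 3) | ‖y - c‖ = r}) ⊆
          T '' {y : EuclideanSpace ℝ (Fin 3) | ‖y - c‖ = r ∧ ‖x - y‖ < ε} := by
  have hT : LinearMap.ker T ≠ ⊥ := LinearMap.ker_ne_bot_of_finrank_lt (by simp)
  rw [image_sphericalCap_eq_image_solidCap T hT hx hε]
  refine ⟨(convex_solidCap c r x ε).linear_image T, ?_⟩
  obtain ⟨δ, hδ, hmem⟩ := exists_homothety_sphere_mem_solidCap hr hx hε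
  refine ⟨δ, hδ, ?_⟩
  rintro _ ⟨s, hs, rfl⟩
  exact ⟨_, hmem s hs, by simp⟩
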